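/- There exists a homogeneous polynomial f₂₂ ∈ ℚ[X₀, X₁, X₂, X₃] of degree 6 such that the restriction of F to the 3-space Z : X₃ = X₆ = X₇ factors as F(X₀, X₁, X₂, X₃, X₃, X₃) = (X₀X₃ − X₁X₂)² · f₂₂(X₀, X₁, X₂, X₃). In particular the intersection of the hypersurface 𝒳 = {F = 0} with Z contains the smooth quadric Q₂₂ : X₀X₃ − X₁X₂ = 0 as a component appearing with multiplicity two. -/

import Mathlib

open MvPolynomial in
/-- The degree-10 polynomial `F = F₁₀ − X₀X₁X₂X₃X₆X₇·F₄` defining the Picard modular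
fourfold `𝒳 ⊂ P⁵`. The variables `X 0, X 1, X 2, X 3, X 4, X 5` stand for the
coordinates `X₀, X₁, X₂, X₃, X₆, X₇`, and `Sᵢ` is the `i`-th elementary symmetric
polynomial in the five squares `X₁², X₂², X₃², X₆², X₇²`. -/
noncomputable def Fpoly : MvPolynomial (Fin 6) ℚ :=
  let a := X 1 ^ 2; let b := X 2 ^ 2; let c := X 3 ^ 2; let d := X 4 ^ 2; let e := X 5 ^ 2
  let S1 := a + b + c + d + e
  let S2 := a*b + a*c + a*d + a*e + b*c + b*d + b*e + c*d + c*e + d*e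
  let S3 := a*b*c + a*b*d + a*b*e + a*c*d + a*c*e + a*d*e + b*c*d + b*c*e + b*d*e + c*d*e
  let S4 := a*b*c*d + a*b*c*e + a*b*d*e + a*c*d*e + b*c*d*e
  let S5 := a*b*c*d*e
  let F4 := -6*S1^2 + 16*S2 + 4*S1*(X 0)^2 + 2*(X 0)^4
  let F10 := S1*S2^2 - 3*S1^2*S3 + 12*S1*S4 - 48*S5 + (-S2^2 + 2*S1*S3 + 4*S4)*(X 0)^2
      + S3*(X 0)^4
  F10 - X 0 * X 1 * X 2 * X 3 * X 4 * X 5 * F4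

open MvPolynomial in
theorem isHomogeneous_C_mul_quaternary {R : Type*} [CommSemiring R] (r : R) {a b c d n : ℕ}
    (h : a + b + c + d = n) :
    (C r * (X 0 ^ a * X 1 ^ b * X 2 ^ c * X 3 ^ d) : MvPolynomial (Fin 4) R).IsHomogeneous n :=
  h ▸ ((((isHomogeneous_X_pow 0 a).mul (isHomogeneous_X_pow 1 b)).mul
    (isHomogeneous_X_pow 2 c)).mul (isHomogeneous_X_pow 3 d)).C_mul r

open MvPolynomial in
/-- The restriction of `F` to the 3-space `Z : X₃ = X₆ = X₇` factors as
`F(X₀,X₁,X₂,X₃,X₃,X₃) = (X₀X₃ − X₁X₂)² · f₂₂` with `f₂₂` homogeneous of degree 6.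
In particular `𝒳 ∩ Z` contains the smooth quadric `Q₂₂ : X₀X₃ − X₁X₂ = 0` as a
component of multiplicity two. -/
theorem stmt_9 :
    ∃ f22 : MvPolynomial (Fin 4) ℚ, f22.IsHomogeneous 6 ∧
      rename (![0, 1, 2, 3, 3, 3] : Fin 6 → Fin 4) Fpoly
        = (X 0 * X 3 - X 1 * X 2) ^ 2 * f22 := by
  refine ⟨
    C (-2) * (X 0 ^ 3 * X 1 ^ 1 * X 2 ^ 1 * X 3 ^ 1) +
    C (-1) * (X 0 ^ 2 * X 1 ^ 2 * X 2 ^ 2 * X 3 ^ 0) +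
    C 3 * (X 0 ^ 2 * X 1 ^ 2 * X 2 ^ 0 * X 3 ^ 2) +
    C 3 * (X 0 ^ 2 * X 1 ^ 0 * X 2 ^ 2 * X 3 ^ 2) +
    C 1 * (X 0 ^ 2 * X 1 ^ 0 * X 2 ^ 0 * X 3 ^ 4) +
    C 2 * (X 0 ^ 1 * X 1 ^ 3 * X 2 ^ 1 * X 3 ^ 1) +
    C 2 * (X 0 ^ 1 * X 1 ^ 1 * X 2 ^ 3 * X 3 ^ 1) +
    C (-10) * (X 0 ^ 1 * X 1 ^ 1 * X 2 ^ 1 * X 3 ^ 3) +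
    C 1 * (X 0 ^ 0 * X 1 ^ 4 * X 2 ^ 2 * X 3 ^ 0) +
    C (-3) * (X 0 ^ 0 * X 1 ^ 4 * X 2 ^ 0 * X 3 ^ 2) +
    C 1 * (X 0 ^ 0 * X 1 ^ 2 * X 2 ^ 4 * X 3 ^ 0) +
    C (-3) * (X 0 ^ 0 * X 1 ^ 2 * X 2 ^ 2 * X 3 ^ 2) +
    C 6 * (X 0 ^ 0 * X 1 ^ 2 * X 2 ^ 0 * X 3 ^ 4) +
    C (-3) * (X 0 ^ 0 * X 1 ^ 0 * X 2 ^ 4 * X 3 ^ 2) +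
    C 6 * (X 0 ^ 0 * X 1 ^ 0 * X 2 ^ 2 * X 3 ^ 4) +
    C (-3) * (X 0 ^ 0 * X 1 ^ 0 * X 2 ^ 0 * X 3 ^ 6), ?_, ?_⟩
  · repeat' apply IsHomogeneous.add
    all_goals exact isHomogeneous_C_mul_quaternary _ rfl
  · simp only [Fpoly, map_add, map_sub, map_neg, map_mul, map_pow, map_ofNat, map_one, rename_X]
    simp only [Matrix.cons_val]
    ring
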